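/- arXiv:1512.04215 — 2 statements merged into one kernel-verified Lean document; each statement's English description precedes it below -/
import Mathlib

section
/- Let U ⊆ ℍ be an axially symmetric slice domain, let D ⊆ ℝ² be such that x + Iy ∈ U whenever (x,y) ∈ D, and let f : U → ℍ. Then f is slice regular on U if and only if there exist two differentiable functions α, β : D → ℍ satisfying α(x,−y) = α(x,y), β(x,−y) = −β(x,y), the Cauchy–Riemann system ∂ₓα − ∂_yβ = 0 and ∂ₓβ + ∂_yα = 0, and such that f(x + Iy) = α(x,y) + Iβ(x,y) for all x + Iy ∈ U. -/
open Quaternion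
open scoped InnerProductSpace

/-- The sphere `𝕊` of purely imaginary unit quaternions. -/
def QSphere : Set ℍ := {q : ℍ | q ^ 2 = -1}

/-- The complex plane `ℂ_I` through `1` and `I`. -/
def slicePlane (I : ℍ) : Set ℍ := {q : ℍ | ∃ x y : ℝ, q = (x : ℍ) + y • I}

/-- A real differentiable `f` is (left) slice regular on `U` if on every slice `U ∩ ℂ_I`
it satisfies the Cauchy-Riemann equation `∂f/∂x + I ∂f/∂y = 0`. -/
def SliceRegularOn (f : ℍ → ℍ) (U : Set ℍ) : Prop :=
  DifferentiableOn ℝ f U ∧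
    ∀ I ∈ QSphere, ∀ q ∈ U ∩ slicePlane I,
      fderiv ℝ f q 1 + I * fderiv ℝ f q I = 0

/-- A slice domain: a connected open set intersecting the real axis whose
intersection with each complex plane `ℂ_I` is connected. -/
def SliceDomain (U : Set ℍ) : Prop :=
  IsOpen U ∧ IsConnected U ∧ (∃ x : ℝ, (x : ℍ) ∈ U) ∧
    ∀ I ∈ QSphere, IsPreconnected (U ∩ slicePlane I)

/-- `U` is axially symmetric if `x + Iy ∈ U` implies `x + Jy ∈ U` for all `J ∈ 𝕊`. -/
def AxiallySymmetric (U : Set ℍ) : Prop :=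
  ∀ (x y : ℝ), ∀ I ∈ QSphere, ((x : ℍ) + y • I) ∈ U →
    ∀ J ∈ QSphere, ((x : ℍ) + y • J) ∈ U

/-- The real-linear parametrization `(x, y) ↦ x + y I` of the slice `ℂ_I`. -/
noncomputable def sliceMap (I : ℍ) : ℝ × ℝ →L[ℝ] ℍ :=
  (ContinuousLinearMap.fst ℝ ℝ ℝ).smulRight 1 + (ContinuousLinearMap.snd ℝ ℝ ℝ).smulRight I

lemma sliceMap_apply (I : ℍ) (p : ℝ × ℝ) : sliceMap I p = (p.1 : ℍ) + p.2 • I := by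
  simp [sliceMap, Algebra.smul_def, ← Quaternion.algebraMap_def]

lemma sliceMap_one_zero (I : ℍ) : sliceMap I (1, 0) = 1 := by simp [sliceMap]

lemma sliceMap_zero_one (I : ℍ) : sliceMap I (0, 1) = I := by simp [sliceMap]

/-- Complex conjugation `(x, y) ↦ (x, -y)` on `ℝ²`. -/
def conjMap : ℝ × ℝ →L[ℝ] ℝ × ℝ :=
  (ContinuousLinearMap.fst ℝ ℝ ℝ).prod (-ContinuousLinearMap.snd ℝ ℝ ℝ)

lemma conjMap_apply (p : ℝ × ℝ) : conjMap p = (p.1, -p.2) := rfl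

lemma QSphere.mul_self {I : ℍ} (hI : I ∈ QSphere) : I * I = -1 := by
  rw [← sq]; exact hI

lemma QSphere.neg_mem {I : ℍ} (hI : I ∈ QSphere) : -I ∈ QSphere := by
  have : I ^ 2 = -1 := hI
  simp [QSphere, this]

lemma QSphere.norm_eq_one {I : ℍ} (hI : I ∈ QSphere) : ‖I‖ = 1 := by
  have h : ‖I ^ 2‖ = 1 := by rw [show I ^ 2 = -1 from hI]; simp
  rw [norm_pow] at h
  exact (pow_eq_one_iff_of_nonneg (norm_nonneg _) two_ne_zero).1 h

lemma QSphere.re_eq_zero {I : ℍ} (hI : I ∈ QSphere) : I.re = 0 := by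
  rw [← Quaternion.sq_eq_neg_normSq, Quaternion.normSq_eq_norm_mul_self, norm_eq_one hI]
  simpa [QSphere] using hI

lemma mem_QSphere_of_re_eq_zero {q : ℍ} (hre : q.re = 0) (hn : Quaternion.normSq q = 1) :
    q ∈ QSphere := by
  have h := Quaternion.sq_eq_neg_normSq.2 hre
  rwa [hn, Quaternion.coe_one] at h

lemma QSphere.nonempty : QSphere.Nonempty :=
  ⟨⟨0, 1, 0, 0⟩, mem_QSphere_of_re_eq_zero rfl
    ((Quaternion.normSq_def' _).trans (by norm_num))⟩

/-- The normalized imaginary part of a non-real quaternion is an imaginary unit. -/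
lemma inv_norm_smul_im_mem_QSphere {q : ℍ} (hq : q.im ≠ 0) : ‖q.im‖⁻¹ • q.im ∈ QSphere := by
  refine mem_QSphere_of_re_eq_zero (by simp) ?_
  rw [Quaternion.normSq_eq_norm_mul_self, norm_smul, norm_inv, norm_norm,
    inv_mul_cancel₀ (norm_ne_zero_iff.2 hq), one_mul]

lemma eq_re_add_norm_smul {q : ℍ} (hq : q.im ≠ 0) :
    q = (q.re : ℍ) + ‖q.im‖ • (‖q.im‖⁻¹ • q.im) := by
  rw [smul_smul, mul_inv_cancel₀ (norm_ne_zero_iff.2 hq), one_smul, Quaternion.re_add_im]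

lemma exists_mem_QSphere_eq (q : ℍ) :
    ∃ I ∈ QSphere, q = (q.re : ℍ) + ‖q.im‖ • I := by
  by_cases hq : q.im = 0
  · obtain ⟨I, hI⟩ := QSphere.nonempty
    refine ⟨I, hI, ?_⟩
    conv_lhs => rw [← Quaternion.re_add_im q]
    simp [hq]
  · exact ⟨_, inv_norm_smul_im_mem_QSphere hq, eq_re_add_norm_smul hq⟩

/-- The coordinates of `x + y I` with respect to `1` and `I`. -/
lemma sliceMap_re_neg_re_mul {I : ℍ} (hI : I ∈ QSphere) (p : ℝ × ℝ) :
    (sliceMap I p).re = p.1 ∧ -(sliceMap I p * I).re = p.2 := by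
  rw [sliceMap_apply]
  simp [add_mul, QSphere.mul_self hI, QSphere.re_eq_zero hI]

lemma isPreconnected_preimage_sliceMap {I : ℍ} (hI : I ∈ QSphere) {U : Set ℍ}
    (hU : IsPreconnected (U ∩ slicePlane I)) :
    IsPreconnected ((fun z : ℂ ↦ sliceMap I (z.re, z.im)) ⁻¹' U) := by
  have hc : Continuous fun q : ℍ ↦ Complex.equivRealProdCLM.symm (q.re, -(q * I).re) :=
    Complex.equivRealProdCLM.symm.continuous.comp (Quaternion.continuous_re.prodMk
      (Quaternion.continuous_re.comp (continuous_id.mul continuous_const)).neg)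
  convert hU.image _ hc.continuousOn using 1
  ext z
  constructor
  · intro hz
    refine ⟨_, ⟨hz, z.re, z.im, sliceMap_apply I _⟩, ?_⟩
    obtain ⟨h1, h2⟩ := sliceMap_re_neg_re_mul hI (z.re, z.im)
    simp only [h1, h2]
    exact Complex.equivRealProdCLM.symm_apply_apply z
  · rintro ⟨_, ⟨hq, x, y, rfl⟩, rfl⟩
    obtain ⟨h1, h2⟩ := sliceMap_re_neg_re_mul hI (x, y)
    simp only [sliceMap_apply] at h1 h2
    simp only [Set.mem_preimage, h1, h2, sliceMap_apply]
    exact hq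

/-- A real-linear functional `ℍ → ℂ` intertwining left multiplication by `I` with
multiplication by `i`, and with real part `⟪c, ·⟫`. -/
noncomputable def sliceFunctional (I c : ℍ) : ℍ →L[ℝ] ℂ :=
  Complex.ofRealCLM.comp (innerSL ℝ c) -
    Complex.I • Complex.ofRealCLM.comp ((innerSL ℝ c).comp (ContinuousLinearMap.mul ℝ ℍ I))

lemma sliceFunctional_apply (I c q : ℍ) :
    sliceFunctional I c q = (⟪c, q⟫_ℝ : ℂ) - Complex.I * (⟪c, I * q⟫_ℝ : ℂ) := by
  simp [sliceFunctional]

lemma sliceFunctional_mul {I : ℍ} (hI : I ∈ QSphere) (c q : ℍ) :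
    sliceFunctional I c (I * q) = Complex.I * sliceFunctional I c q := by
  rw [sliceFunctional_apply, sliceFunctional_apply, ← mul_assoc, QSphere.mul_self hI, mul_sub,
    ← mul_assoc, Complex.I_mul_I]
  simp
  ring

/-- Identity principle: a solution of the slice Cauchy-Riemann equation on an open connected
set that vanishes on the real axis vanishes identically. -/
lemma eq_zero_of_slice_cauchyRiemann {I : ℍ} (hI : I ∈ QSphere) {D : Set (ℝ × ℝ)}
    (hD : IsOpen D) (hDc : IsPreconnected ((fun z : ℂ ↦ (z.re, z.im)) ⁻¹' D))
    {x₀ : ℝ} (hx₀ : (x₀, (0 : ℝ)) ∈ D) {g : ℝ × ℝ → ℍ} (hg : DifferentiableOn ℝ g D)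
    (hCR : ∀ p ∈ D, fderiv ℝ g p (1, 0) + I * fderiv ℝ g p (0, 1) = 0)
    (h0 : ∀ x : ℝ, (x, (0 : ℝ)) ∈ D → g (x, 0) = 0) {p : ℝ × ℝ} (hp : p ∈ D) : g p = 0 := by
  set e : ℂ →L[ℝ] ℝ × ℝ := Complex.equivRealProdCLM.toContinuousLinearMap with he
  have he' : ∀ z, e z = (z.re, z.im) := fun z ↦ rfl
  have hW : IsOpen (e ⁻¹' D) := hD.preimage e.continuous
  have key : ∀ c : ℍ, Set.EqOn (fun z ↦ sliceFunctional I c (g (e z))) 0 (e ⁻¹' D) := by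
    intro c
    have hdiff : DifferentiableOn ℂ (fun z ↦ sliceFunctional I c (g (e z))) (e ⁻¹' D) := by
      intro z hz
      have hgz : DifferentiableAt ℝ g (e z) := hg.differentiableAt (hD.mem_nhds hz)
      have hder : HasFDerivAt (fun z ↦ sliceFunctional I c (g (e z)))
          ((sliceFunctional I c).comp ((fderiv ℝ g (e z)).comp e)) z :=
        (sliceFunctional I c).hasFDerivAt.comp z (hgz.hasFDerivAt.comp z e.hasFDerivAt)
      refine (differentiableAt_complex_iff_differentiableAt_real.2
        ⟨hder.differentiableAt, ?_⟩).differentiableWithinAt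
      rw [hder.fderiv]
      have h1 : fderiv ℝ g (e z) (0, 1) = I * fderiv ℝ g (e z) (1, 0) := by
        have h := congrArg (I * ·) (hCR _ hz)
        simp only [mul_add, ← mul_assoc, QSphere.mul_self hI, mul_zero] at h
        rw [neg_one_mul, ← sub_eq_add_neg, sub_eq_zero] at h
        exact h.symm
      have hI1 : e Complex.I = (0, 1) := by simp [he']
      have h11 : e 1 = (1, 0) := by simp [he']
      simp only [ContinuousLinearMap.comp_apply, hI1, h11, h1, sliceFunctional_mul hI,
        smul_eq_mul]
    refine (hdiff.analyticOnNhd hW).eqOn_zero_of_preconnected_of_frequently_eq_zero hDc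
      (z₀ := (x₀ : ℂ)) (by simpa [he'] using hx₀) ?_
    have ht : Filter.Tendsto (fun x : ℝ ↦ (x : ℂ)) (nhdsWithin x₀ {x₀}ᶜ)
        (nhdsWithin (x₀ : ℂ) {(x₀ : ℂ)}ᶜ) := by
      refine tendsto_nhdsWithin_of_tendsto_nhds_of_eventually_within _
        (Complex.continuous_ofReal.continuousAt.mono_left nhdsWithin_le_nhds) ?_
      filter_upwards [self_mem_nhdsWithin] with x hx
      simpa using hx
    refine ht.frequently (Filter.Eventually.frequently ?_)
    have hc : ContinuousAt (fun x : ℝ ↦ (x, (0 : ℝ))) x₀ := by fun_prop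
    filter_upwards [nhdsWithin_le_nhds (hc.preimage_mem_nhds (hD.mem_nhds hx₀))] with x hx
    simp [he', h0 x hx]
  have h := key (g p) (x := Complex.equivRealProdCLM.symm p) (by simpa [he] using hp)
  simp only [he, ContinuousLinearEquiv.coe_coe, ContinuousLinearEquiv.apply_symm_apply,
    sliceFunctional_apply, Pi.zero_apply] at h
  have hre := congrArg Complex.re h
  rw [Complex.sub_re, Complex.I_mul_re, Complex.ofReal_im, neg_zero, sub_zero, Complex.ofReal_re,
    Complex.zero_re] at hre
  exact inner_self_eq_zero.1 hre

/-- If `f(x + I y) = α(x, y) + I β(x, y)`, the slice Cauchy-Riemann operator of `f` is given by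
that of `α` and `β`. -/
lemma fderiv_sliceMap_of_eventuallyEq {I : ℍ} {f : ℍ → ℍ} {α β : ℝ × ℝ → ℍ} {p : ℝ × ℝ}
    (hf : DifferentiableAt ℝ f (sliceMap I p)) (hα : DifferentiableAt ℝ α p)
    (hβ : DifferentiableAt ℝ β p)
    (h : (fun p ↦ f (sliceMap I p)) =ᶠ[nhds p] fun p ↦ α p + I * β p) (v : ℝ × ℝ) :
    fderiv ℝ f (sliceMap I p) (sliceMap I v) = fderiv ℝ α p v + I * fderiv ℝ β p v := by
  have h1 : HasFDerivAt (fun p ↦ f (sliceMap I p))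
      ((fderiv ℝ f (sliceMap I p)).comp (sliceMap I)) p :=
    hf.hasFDerivAt.comp p (sliceMap I).hasFDerivAt
  have h2 := (hα.hasFDerivAt.add (hβ.hasFDerivAt.const_mul I)).congr_of_eventuallyEq h
  simpa using DFunLike.congr_fun (h1.unique h2) v

/-- Differentiability at a real point of a function built from an even-odd pair `α, β`. -/
lemma differentiableAt_coe_of_even_odd {f : ℍ → ℍ} {α β : ℝ × ℝ → ℍ} {x₀ : ℝ}
    {A B : ℝ × ℝ →L[ℝ] ℍ} (hα : HasFDerivAt α A (x₀, 0)) (hβ : HasFDerivAt β B (x₀, 0))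
    (hβ0 : β (x₀, 0) = 0) (hA : A (0, 1) = 0) (hB : B (1, 0) = 0) (hAB : A (1, 0) = B (0, 1))
    (hf : ∀ᶠ q in nhds (x₀ : ℍ), ∀ I ∈ QSphere, q = (q.re : ℍ) + ‖q.im‖ • I →
      f q = α (q.re, ‖q.im‖) + I * β (q.re, ‖q.im‖)) :
    DifferentiableAt ℝ f (x₀ : ℍ) := by
  set a := A (1, 0)
  have hAv : ∀ v, A v = v.1 • a := fun v ↦ by
    have : v = v.1 • ((1, 0) : ℝ × ℝ) + v.2 • ((0, 1) : ℝ × ℝ) := by ext <;> simp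
    conv_lhs => rw [this]
    rw [map_add, map_smul, map_smul, hA, smul_zero, add_zero]
  have hBv : ∀ v, B v = v.2 • a := fun v ↦ by
    have : v = v.1 • ((1, 0) : ℝ × ℝ) + v.2 • ((0, 1) : ℝ × ℝ) := by ext <;> simp
    conv_lhs => rw [this]
    rw [map_add, map_smul, map_smul, hB, smul_zero, zero_add, hAB]
  have hpc : Continuous fun q : ℍ ↦ (q.re, ‖q.im‖) :=
    Quaternion.continuous_re.prodMk Quaternion.continuous_im.norm
  have hp : Filter.Tendsto (fun q : ℍ ↦ (q.re, ‖q.im‖)) (nhds (x₀ : ℍ)) (nhds (x₀, 0)) := by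
    simpa using hpc.tendsto (x₀ : ℍ)
  have hpO : (fun q : ℍ ↦ ((q.re, ‖q.im‖) : ℝ × ℝ) - (x₀, 0)) =O[nhds (x₀ : ℍ)]
      fun q ↦ q - (x₀ : ℍ) := by
    refine Asymptotics.IsBigO.of_bound 1 (Filter.Eventually.of_forall fun q ↦ ?_)
    have hn : ‖q - (x₀ : ℍ)‖ ^ 2 = (q.re - x₀) ^ 2 + ‖q.im‖ ^ 2 := by
      simp only [sq, ← Quaternion.normSq_eq_norm_mul_self, Quaternion.normSq_def']
      simp
      ring
    rw [one_mul, Prod.norm_def]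
    simp only [Prod.mk_sub_mk, sub_zero, Real.norm_eq_abs, abs_norm]
    refine max_le (abs_le_of_sq_le_sq ?_ (norm_nonneg _)) (le_of_sq_le_sq ?_ (norm_nonneg _)) <;>
    nlinarith [sq_nonneg (q.re - x₀), sq_nonneg ‖q.im‖]
  have hα' := (hα.isLittleO.comp_tendsto hp).trans_isBigO hpO
  have hβ' := (hβ.isLittleO.comp_tendsto hp).trans_isBigO hpO
  have hf0 : f x₀ = α (x₀, 0) := by
    obtain ⟨I, hI⟩ := QSphere.nonempty
    simpa [hβ0] using hf.self_of_nhds I hI (by simp)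
  refine HasFDerivAt.differentiableAt
    (f' := (ContinuousLinearMap.mul ℝ ℍ).flip a) (.of_isLittleO ?_)
  refine Asymptotics.IsBigO.trans_isLittleO ?_ (hα'.norm_left.add hβ'.norm_left)
  refine Asymptotics.IsBigO.of_bound 1 ?_
  filter_upwards [hf] with q hq
  obtain ⟨I, hI, hqI⟩ := exists_mem_QSphere_eq q
  rw [hq I hI hqI, hf0, one_mul]
  simp only [Function.comp_apply, hAv, hBv, hβ0, Prod.mk_sub_mk, sub_zero,
    ContinuousLinearMap.flip_apply, ContinuousLinearMap.mul_apply']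
  have : α (q.re, ‖q.im‖) + I * β (q.re, ‖q.im‖) - α (x₀, 0) - (q - (x₀ : ℍ)) * a =
      (α (q.re, ‖q.im‖) - α (x₀, 0) - (q.re - x₀) • a) +
        I * (β (q.re, ‖q.im‖) - ‖q.im‖ • a) := by
    have hqa : (q - (x₀ : ℍ)) * a = (q.re - x₀) • a + I * (‖q.im‖ • a) := by
      conv_lhs => rw [hqI]
      rw [← Quaternion.coe_mul_eq_smul (q.re - x₀), Quaternion.coe_sub, mul_smul_comm,
        ← smul_mul_assoc]
      noncomm_ring
    rw [hqa]
    noncomm_ring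
  rw [this]
  refine (norm_add_le _ _).trans ?_
  rw [norm_mul, QSphere.norm_eq_one hI, one_mul]
  exact le_abs_self _

/-- Differentiability at a non-real point of a function built from a pair `α, β`. -/
lemma differentiableAt_of_im_ne_zero {f : ℍ → ℍ} {α β : ℝ × ℝ → ℍ} {q₀ : ℍ} (hq₀ : q₀.im ≠ 0)
    (hα : DifferentiableAt ℝ α (q₀.re, ‖q₀.im‖)) (hβ : DifferentiableAt ℝ β (q₀.re, ‖q₀.im‖))
    (hf : ∀ᶠ q in nhds q₀, ∀ I ∈ QSphere, q = (q.re : ℍ) + ‖q.im‖ • I →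
      f q = α (q.re, ‖q.im‖) + I * β (q.re, ‖q.im‖)) :
    DifferentiableAt ℝ f q₀ := by
  have hre : DifferentiableAt ℝ (fun q : ℍ ↦ q.re) q₀ := by
    have : (fun q : ℍ ↦ q.re) = fun q : ℍ ↦ ⟪(1 : ℍ), q⟫_ℝ := by
      ext q; simp [Quaternion.inner_def]
    rw [this]
    exact (innerSL ℝ (1 : ℍ)).differentiableAt
  have him : DifferentiableAt ℝ (fun q : ℍ ↦ q.im) q₀ := by
    have : (fun q : ℍ ↦ q.im) = fun q : ℍ ↦ q - q.re • (1 : ℍ) := by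
      ext q <;> simp
    rw [this]
    exact differentiableAt_id.sub (hre.smul_const _)
  have hn : DifferentiableAt ℝ (fun q : ℍ ↦ ‖q.im‖) q₀ := him.norm ℝ hq₀
  have hp : DifferentiableAt ℝ (fun q : ℍ ↦ (q.re, ‖q.im‖)) q₀ := hre.prodMk hn
  have hd : DifferentiableAt ℝ (fun q : ℍ ↦ α (q.re, ‖q.im‖) +
      (‖q.im‖⁻¹ • q.im) * β (q.re, ‖q.im‖)) q₀ :=
    (DifferentiableAt.comp q₀ (g := α) hα hp).add
      (((hn.inv (norm_ne_zero_iff.2 hq₀)).smul him).mul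
        (DifferentiableAt.comp q₀ (g := β) hβ hp))
  refine hd.congr_of_eventuallyEq ?_
  filter_upwards [hf, him.continuousAt.eventually_ne hq₀] with q hq hne
  exact hq _ (inv_norm_smul_im_mem_QSphere hne) (eq_re_add_norm_smul hne)

/-- The second partial derivative of a function even in `y` vanishes
at real points. -/
lemma fderiv_zero_one_eq_zero_of_even {α : ℝ × ℝ → ℍ} {x₀ : ℝ}
    (hα : DifferentiableAt ℝ α (x₀, 0))
    (heven : ∀ᶠ p in nhds (x₀, (0 : ℝ)), α (p.1, -p.2) = α p) :
    fderiv ℝ α (x₀, 0) (0, 1) = 0 := by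
  have hc : conjMap (x₀, 0) = (x₀, 0) := by simp [conjMap_apply]
  have h1 : HasFDerivAt (fun p ↦ α (conjMap p))
      ((fderiv ℝ α (x₀, 0)).comp conjMap) (x₀, 0) := by
    refine HasFDerivAt.comp (x₀, 0) (g := α) ?_ conjMap.hasFDerivAt
    rw [hc]
    exact hα.hasFDerivAt
  have h2 : HasFDerivAt (fun p ↦ α (conjMap p)) (fderiv ℝ α (x₀, 0)) (x₀, 0) :=
    hα.hasFDerivAt.congr_of_eventuallyEq heven
  have h3 := DFunLike.congr_fun (h1.unique h2) (0, 1)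
  have h4 : conjMap (0, 1) = -(0, 1) := by simp [conjMap_apply]
  rw [ContinuousLinearMap.comp_apply, h4, map_neg] at h3
  have := IsAddTorsionFree.of_isTorsionFree ℝ ℍ
  exact self_eq_neg.1 h3.symm

/-- The even component of the representation formula, computed on the slice `ℂ_J`. -/
noncomputable def evenPart (f : ℍ → ℍ) (J : ℍ) (p : ℝ × ℝ) : ℍ :=
  (2⁻¹ : ℝ) • (f (sliceMap J p) + f (sliceMap J (conjMap p)))

/-- The odd component of the representation formula, computed on the slice `ℂ_J`. -/
noncomputable def oddPart (f : ℍ → ℍ) (J : ℍ) (p : ℝ × ℝ) : ℍ :=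
  (2⁻¹ : ℝ) • (J * (f (sliceMap J (conjMap p)) - f (sliceMap J p)))

lemma conjMap_conjMap (p : ℝ × ℝ) : conjMap (conjMap p) = p := by simp [conjMap_apply]

lemma evenPart_conjMap (f : ℍ → ℍ) (J : ℍ) (p : ℝ × ℝ) :
    evenPart f J (conjMap p) = evenPart f J p := by
  simp only [evenPart, conjMap_conjMap, add_comm]

lemma oddPart_conjMap (f : ℍ → ℍ) (J : ℍ) (p : ℝ × ℝ) :
    oddPart f J (conjMap p) = -oddPart f J p := by
  rw [oddPart, oddPart, conjMap_conjMap, ← smul_neg, ← mul_neg, neg_sub]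

section Parts

variable {f : ℍ → ℍ} {J : ℍ} {p : ℝ × ℝ}

lemma hasFDerivAt_evenPart (h1 : DifferentiableAt ℝ f (sliceMap J p))
    (h2 : DifferentiableAt ℝ f (sliceMap J (conjMap p))) :
    HasFDerivAt (evenPart f J) ((2⁻¹ : ℝ) • ((fderiv ℝ f (sliceMap J p)).comp (sliceMap J) +
      (fderiv ℝ f (sliceMap J (conjMap p))).comp ((sliceMap J).comp conjMap))) p :=
  ((h1.hasFDerivAt.comp p (sliceMap J).hasFDerivAt).add
    (HasFDerivAt.comp p (g := f) (f := (sliceMap J).comp conjMap) h2.hasFDerivAt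
      ((sliceMap J).comp conjMap).hasFDerivAt)).const_smul (2⁻¹ : ℝ)

lemma hasFDerivAt_oddPart (h1 : DifferentiableAt ℝ f (sliceMap J p))
    (h2 : DifferentiableAt ℝ f (sliceMap J (conjMap p))) :
    HasFDerivAt (oddPart f J) ((2⁻¹ : ℝ) • (J •
      ((fderiv ℝ f (sliceMap J (conjMap p))).comp ((sliceMap J).comp conjMap) -
        (fderiv ℝ f (sliceMap J p)).comp (sliceMap J)))) p :=
  (((HasFDerivAt.comp p (g := f) (f := (sliceMap J).comp conjMap) h2.hasFDerivAt
      ((sliceMap J).comp conjMap).hasFDerivAt).sub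
    (h1.hasFDerivAt.comp p (sliceMap J).hasFDerivAt)).const_mul J).const_smul (2⁻¹ : ℝ)

lemma conjMap_one_zero : conjMap (1, 0) = (1, 0) := by simp [conjMap_apply]

lemma conjMap_zero_one : conjMap (0, 1) = -(0, 1) := by simp [conjMap_apply]

/-- The components of the representation formula satisfy the Cauchy-Riemann system. -/
lemma cauchyRiemann_evenPart_oddPart (hJ : J ∈ QSphere)
    (h1 : DifferentiableAt ℝ f (sliceMap J p))
    (h2 : DifferentiableAt ℝ f (sliceMap J (conjMap p)))
    (hCR1 : fderiv ℝ f (sliceMap J p) 1 + J * fderiv ℝ f (sliceMap J p) J = 0)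
    (hCR2 : fderiv ℝ f (sliceMap J (conjMap p)) 1 +
      J * fderiv ℝ f (sliceMap J (conjMap p)) J = 0) :
    fderiv ℝ (evenPart f J) p (1, 0) - fderiv ℝ (oddPart f J) p (0, 1) = 0 ∧
      fderiv ℝ (oddPart f J) p (1, 0) + fderiv ℝ (evenPart f J) p (0, 1) = 0 := by
  rw [(hasFDerivAt_evenPart h1 h2).fderiv, (hasFDerivAt_oddPart h1 h2).fderiv]
  simp only [smul_apply, add_apply,
    sub_apply, ContinuousLinearMap.comp_apply, conjMap_one_zero,
    conjMap_zero_one, map_neg, sliceMap_one_zero, sliceMap_zero_one, smul_eq_mul,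
    eq_neg_of_add_eq_zero_left hCR1, eq_neg_of_add_eq_zero_left hCR2, ← smul_sub, ← smul_add]
  constructor
  · rw [smul_eq_zero_of_right]
    noncomm_ring
  · rw [smul_eq_zero_of_right]
    simp only [mul_sub, mul_neg, ← mul_assoc, QSphere.mul_self hJ]
    noncomm_ring

end Parts

/-- `f` is slice regular on an axially symmetric slice domain `U` if and only if
`f(x+Iy) = α(x,y) + Iβ(x,y)` for differentiable `α, β` on `D` that are even/odd in `y`
and satisfy the Cauchy-Riemann system. -/
theorem slice_regular_iff_alpha_beta (U : Set ℍ) (hdom : SliceDomain U)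
    (hsym : AxiallySymmetric U) (D : Set (ℝ × ℝ))
    (hD1 : ∀ p ∈ D, ∀ I ∈ QSphere, ((p.1 : ℍ) + p.2 • I) ∈ U)
    (hD2 : ∀ x y : ℝ, ∀ I ∈ QSphere, ((x : ℍ) + y • I) ∈ U → (x, y) ∈ D)
    (f : ℍ → ℍ) :
    SliceRegularOn f U ↔
      ∃ α β : ℝ × ℝ → ℍ,
        DifferentiableOn ℝ α D ∧ DifferentiableOn ℝ β D ∧
        (∀ p ∈ D, α (p.1, -p.2) = α p) ∧
        (∀ p ∈ D, β (p.1, -p.2) = -β p) ∧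
        (∀ p ∈ D, fderiv ℝ α p (1, 0) - fderiv ℝ β p (0, 1) = 0) ∧
        (∀ p ∈ D, fderiv ℝ β p (1, 0) + fderiv ℝ α p (0, 1) = 0) ∧
        (∀ x y : ℝ, ∀ I ∈ QSphere, ((x : ℍ) + y • I) ∈ U →
          f ((x : ℍ) + y • I) = α (x, y) + I * β (x, y)) := by
  obtain ⟨hU, -, ⟨x₀, hx₀⟩, hpre⟩ := hdom
  have hmem : ∀ I ∈ QSphere, ∀ p, p ∈ D ↔ sliceMap I p ∈ U := fun I hI p ↦ by
    rw [sliceMap_apply]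
    exact ⟨fun h ↦ hD1 p h I hI, fun h ↦ hD2 p.1 p.2 I hI h⟩
  obtain ⟨J, hJ⟩ := QSphere.nonempty
  have hDpre : ∀ I ∈ QSphere, D = sliceMap I ⁻¹' U := fun I hI ↦ Set.ext (hmem I hI)
  have hDo : IsOpen D := by
    rw [hDpre J hJ]
    exact hU.preimage (sliceMap J).continuous
  have hconj : ∀ p ∈ D, conjMap p ∈ D := fun p hp ↦ by
    rw [hmem J hJ, show sliceMap J (conjMap p) = sliceMap (-J) p by
      simp [sliceMap_apply, conjMap_apply]]
    exact (hmem _ (QSphere.neg_mem hJ) p).1 hp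
  constructor
  · rintro ⟨hf, hCR⟩
    have hfd : ∀ I ∈ QSphere, ∀ p ∈ D, DifferentiableAt ℝ f (sliceMap I p) := fun I hI p hp ↦
      hf.differentiableAt (hU.mem_nhds ((hmem I hI p).1 hp))
    have hfCR : ∀ I ∈ QSphere, ∀ p ∈ D,
        fderiv ℝ f (sliceMap I p) 1 + I * fderiv ℝ f (sliceMap I p) I = 0 := fun I hI p hp ↦
      hCR I hI _ ⟨(hmem I hI p).1 hp, p.1, p.2, sliceMap_apply I p⟩
    have hα : ∀ p ∈ D, DifferentiableAt ℝ (evenPart f J) p := fun p hp ↦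
      (hasFDerivAt_evenPart (hfd J hJ p hp) (hfd J hJ _ (hconj p hp))).differentiableAt
    have hβ : ∀ p ∈ D, DifferentiableAt ℝ (oddPart f J) p := fun p hp ↦
      (hasFDerivAt_oddPart (hfd J hJ p hp) (hfd J hJ _ (hconj p hp))).differentiableAt
    have hαβ := fun p hp ↦ cauchyRiemann_evenPart_oddPart hJ (hfd J hJ p hp)
      (hfd J hJ _ (hconj p hp)) (hfCR J hJ p hp) (hfCR J hJ _ (hconj p hp))
    refine ⟨evenPart f J, oddPart f J, fun p hp ↦ (hα p hp).differentiableWithinAt,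
      fun p hp ↦ (hβ p hp).differentiableWithinAt, fun p _ ↦ evenPart_conjMap f J p,
      fun p _ ↦ oddPart_conjMap f J p, fun p hp ↦ (hαβ p hp).1, fun p hp ↦ (hαβ p hp).2, ?_⟩
    intro x y I hI hxy
    have hDc : IsPreconnected ((fun z : ℂ ↦ (z.re, z.im)) ⁻¹' D) := by
      rw [hDpre I hI]
      exact isPreconnected_preimage_sliceMap hI (hpre I hI)
    have hder : ∀ p ∈ D, HasFDerivAt
        (fun p ↦ f (sliceMap I p) - (evenPart f J p + I * oddPart f J p))
        ((fderiv ℝ f (sliceMap I p)).comp (sliceMap I) -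
          (fderiv ℝ (evenPart f J) p + I • fderiv ℝ (oddPart f J) p)) p := fun p hp ↦
      ((hfd I hI p hp).hasFDerivAt.comp p (sliceMap I).hasFDerivAt).sub
        ((hα p hp).hasFDerivAt.add ((hβ p hp).hasFDerivAt.const_mul I))
    have hzero := eq_zero_of_slice_cauchyRiemann hI hDo hDc (x₀ := x₀)
      (by rw [hmem I hI, sliceMap_apply]; simpa using hx₀)
      (fun p hp ↦ (hder p hp).differentiableAt.differentiableWithinAt) ?_ ?_
      (hD2 x y I hI hxy)
    · rwa [sliceMap_apply, sub_eq_zero] at hzero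
    · intro p hp
      rw [(hder p hp).fderiv]
      simp only [smul_apply, add_apply,
        sub_apply, ContinuousLinearMap.comp_apply, sliceMap_one_zero,
        sliceMap_zero_one, smul_eq_mul, eq_neg_of_add_eq_zero_left (hfCR I hI p hp),
        sub_eq_zero.1 (hαβ p hp).1, eq_neg_of_add_eq_zero_left (hαβ p hp).2,
        mul_sub, mul_add, ← mul_assoc, QSphere.mul_self hI]
      noncomm_ring
    · intro t _
      simp [evenPart, oddPart, sliceMap_apply, conjMap_apply, ← two_smul ℝ, smul_smul]
  · rintro ⟨α, β, hα, hβ, heven, hodd, hCR1, hCR2, hrep⟩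
    have hα' : ∀ p ∈ D, DifferentiableAt ℝ α p := fun p hp ↦
      hα.differentiableAt (hDo.mem_nhds hp)
    have hβ' : ∀ p ∈ D, DifferentiableAt ℝ β p := fun p hp ↦
      hβ.differentiableAt (hDo.mem_nhds hp)
    have hrep' : ∀ q₀ ∈ U, ∀ᶠ q in nhds q₀, ∀ I ∈ QSphere, q = (q.re : ℍ) + ‖q.im‖ • I →
        f q = α (q.re, ‖q.im‖) + I * β (q.re, ‖q.im‖) := fun q₀ hq₀ ↦ by
      filter_upwards [hU.mem_nhds hq₀] with q hq I hI hqI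
      rw [← hrep _ _ I hI (hqI ▸ hq), ← hqI]
    have hfd : ∀ q ∈ U, DifferentiableAt ℝ f q := by
      intro q hq
      have hqD : (q.re, ‖q.im‖) ∈ D := by
        obtain ⟨I, hI, hqI⟩ := exists_mem_QSphere_eq q
        exact hD2 _ _ I hI (hqI ▸ hq)
      by_cases him : q.im = 0
      · obtain ⟨x, rfl⟩ : ∃ x : ℝ, q = x := ⟨q.re, by
          conv_lhs => rw [← Quaternion.re_add_im q]
          simp [him]⟩
        have hxD : (x, (0 : ℝ)) ∈ D := by simpa using hqD
        have hαy : fderiv ℝ α (x, 0) (0, 1) = 0 :=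
          fderiv_zero_one_eq_zero_of_even (hα' _ hxD)
            (Filter.mem_of_superset (hDo.mem_nhds hxD) heven)
        refine differentiableAt_coe_of_even_odd (hα' _ hxD).hasFDerivAt (hβ' _ hxD).hasFDerivAt
          ?_ hαy ?_ (sub_eq_zero.1 (hCR1 _ hxD)) (hrep' _ hq)
        · have h := hodd _ hxD
          simp only [neg_zero] at h
          have := IsAddTorsionFree.of_isTorsionFree ℝ ℍ
          exact self_eq_neg.1 h
        · simpa [hαy] using hCR2 _ hxD
      · exact differentiableAt_of_im_ne_zero him (hα' _ hqD) (hβ' _ hqD) (hrep' _ hq)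
    refine ⟨fun q hq ↦ (hfd q hq).differentiableWithinAt, ?_⟩
    rintro I hI _ ⟨hq, x, y, rfl⟩
    have hp : (x, y) ∈ D := hD2 x y I hI hq
    have hev : (fun p ↦ f (sliceMap I p)) =ᶠ[nhds (x, y)] fun p ↦ α p + I * β p := by
      filter_upwards [hDo.mem_nhds hp] with p hp'
      rw [sliceMap_apply]
      exact hrep _ _ I hI (hD1 p hp' I hI)
    rw [← sliceMap_apply I (x, y)] at hq ⊢
    have hfder := fderiv_sliceMap_of_eventuallyEq (hfd _ hq) (hα' _ hp) (hβ' _ hp) hev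
    have h1 := hfder (1, 0)
    have h2 := hfder (0, 1)
    rw [sliceMap_one_zero] at h1
    rw [sliceMap_zero_one] at h2
    rw [h1, h2, sub_eq_zero.1 (hCR1 _ hp), eq_neg_of_add_eq_zero_left (hCR2 _ hp), mul_add,
      ← mul_assoc, QSphere.mul_self hI]
    noncomm_ring
end

section
/- Let U ⊆ ℍ be an axially symmetric slice domain and let {1, I, J, IJ} be a basis of ℍ with I, J ∈ 𝕊 and ⟨I,J⟩ = 0. Then every slice regular function f : U → ℍ can be written in exactly one way as f = f₀ + f₁·I + f₂·J + f₃·IJ, where each fₗ (ℓ = 0,1,2,3) is a quaternionic intrinsic slice regular function on U; i.e. the right ℍ-module of slice regular functions on U decomposes as the direct sum 𝒩(U) ⊕ 𝒩(U)I ⊕ 𝒩(U)J ⊕ 𝒩(U)IJ. -/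
open Quaternion
open scoped InnerProductSpace

/-- A quaternionic intrinsic function: slice regular on `U` and mapping each slice
`U ∩ ℂ_I` into `ℂ_I`. -/
def IntrinsicOn (f : ℍ → ℍ) (U : Set ℍ) : Prop :=
  SliceRegularOn f U ∧ ∀ I ∈ QSphere, ∀ q ∈ U ∩ slicePlane I, f q ∈ slicePlane I

theorem mem_QSphere_iff {K : ℍ} : K ∈ QSphere ↔ K * K = -1 := by
  rw [QSphere, Set.mem_ofPred_eq, sq]

theorem QSphere.re_eq_zero_s5 {K : ℍ} (hK : K ∈ QSphere) : K.re = 0 := by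
  rw [mem_QSphere_iff] at hK
  simp only [Quaternion.ext_iff, Quaternion.re_mul, Quaternion.imI_mul, Quaternion.imJ_mul,
    Quaternion.imK_mul, Quaternion.re_neg, Quaternion.imI_neg, Quaternion.imJ_neg,
    Quaternion.imK_neg, Quaternion.re_one, Quaternion.imI_one, Quaternion.imJ_one,
    Quaternion.imK_one] at hK
  obtain ⟨h0, h1, h2, h3⟩ := hK
  by_contra h
  have e1 : K.imI = 0 := mul_left_cancel₀ h (by linarith)
  have e2 : K.imJ = 0 := mul_left_cancel₀ h (by linarith)
  have e3 : K.imK = 0 := mul_left_cancel₀ h (by linarith)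
  rw [e1, e2, e3] at h0
  nlinarith [sq_nonneg K.re]

theorem QSphere.anticomm {I J : ℍ} (hI : I ∈ QSphere) (hJ : J ∈ QSphere)
    (hIJ : ⟪I, J⟫_ℝ = 0) : J * I = -(I * J) := by
  have h1 := QSphere.re_eq_zero_s5 hI
  have h2 := QSphere.re_eq_zero_s5 hJ
  rw [Quaternion.inner_def] at hIJ
  simp [h1, h2] at hIJ
  ext <;> simp [h1, h2] <;> linarith

/-- Every quaternion lies in some slice. -/
theorem exists_mem_slicePlane (q : ℍ) : ∃ K ∈ QSphere, q ∈ slicePlane K := by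
  by_cases h : q.im = 0
  · have hI : ((Complex.I : ℂ) : ℍ) ∈ QSphere := by
      rw [mem_QSphere_iff, ← Quaternion.coeComplex_mul, Complex.I_mul_I]
      ext <;> simp
    exact ⟨_, hI, q.re, 0, by simpa [h] using (Quaternion.re_add_im q).symm⟩
  · have hn : ‖q.im‖ ≠ 0 := norm_ne_zero_iff.mpr h
    refine ⟨‖q.im‖⁻¹ • q.im, ?_, q.re, ‖q.im‖, ?_⟩
    · have h1 : q.im * q.im = -((‖q.im‖ * ‖q.im‖ : ℝ) : ℍ) := by
        rw [← Quaternion.normSq_eq_norm_mul_self, ← Quaternion.self_mul_star]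
        simp
      rw [mem_QSphere_iff, smul_mul_smul_comm, h1, smul_neg, Quaternion.smul_coe,
        ← mul_inv, inv_mul_cancel₀ (mul_ne_zero hn hn), Quaternion.coe_one]
    · rw [smul_inv_smul₀ hn, Quaternion.re_add_im]

theorem coe_mem_slicePlane (x : ℝ) (K : ℍ) : (x : ℍ) ∈ slicePlane K := ⟨x, 0, by simp⟩

theorem mem_slicePlane_of_commute {K h : ℍ} (hK : K ∈ QSphere) (hc : h * K = K * h) :
    h ∈ slicePlane K := by
  have h1 := QSphere.re_eq_zero_s5 hK
  rw [mem_QSphere_iff] at hK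
  have h2 : K.imI * K.imI + K.imJ * K.imJ + K.imK * K.imK = 1 := by
    have := congrArg (fun q : ℍ => q.re) hK
    simp [h1] at this
    linarith
  simp only [Quaternion.ext_iff, Quaternion.re_mul, Quaternion.imI_mul, Quaternion.imJ_mul,
    Quaternion.imK_mul, h1] at hc
  obtain ⟨-, c1, c2, c3⟩ := hc
  refine ⟨h.re, h.imI * K.imI + h.imJ * K.imJ + h.imK * K.imK, ?_⟩
  ext <;> simp [h1]
  · linear_combination (-h.imI) * h2 + (K.imJ * c3 - K.imK * c2) / 2
  · linear_combination (-h.imJ) * h2 + (K.imK * c1 - K.imI * c3) / 2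
  · linear_combination (-h.imK) * h2 + (K.imI * c2 - K.imJ * c1) / 2

theorem eq_coe_of_mem_slicePlane {I J h : ℍ} (hI : I ∈ QSphere) (hJ : J ∈ QSphere)
    (hIJ : ⟪I, J⟫_ℝ = 0) (h1 : h ∈ slicePlane I) (h2 : h ∈ slicePlane J) :
    ∃ r : ℝ, h = r := by
  obtain ⟨a, b, rfl⟩ := h1
  obtain ⟨c, d, h2⟩ := h2
  have hac : a = c := by
    simpa [QSphere.re_eq_zero_s5 hI, QSphere.re_eq_zero_s5 hJ] using congrArg (fun q : ℍ => q.re) h2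
  rw [hac, add_right_inj] at h2
  have h3 : b * ⟪I, I⟫_ℝ = 0 := by
    rw [← real_inner_smul_right, h2, real_inner_smul_right, hIJ, mul_zero]
  have hI0 : I ≠ 0 := by
    rintro rfl
    simp [QSphere] at hI
  have hb : b = 0 := (mul_eq_zero.mp h3).resolve_right (inner_self_ne_zero.mpr hI0)
  exact ⟨a, by simp [hb]⟩

theorem coe_eq_zero_of_basis_sum_eq_zero {I J : ℍ} (hI : I ∈ QSphere) (hJ : J ∈ QSphere)
    (hIJ : ⟪I, J⟫_ℝ = 0) {a b c d : ℝ}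
    (h : (a : ℍ) + b * I + c * J + d * (I * J) = 0) : a = 0 ∧ b = 0 ∧ c = 0 ∧ d = 0 := by
  have hJI := QSphere.anticomm hI hJ hIJ
  have rI := QSphere.re_eq_zero_s5 hI
  have rJ := QSphere.re_eq_zero_s5 hJ
  have rIJ : (I * J).re = 0 := by
    have h1 : (J * I).re = (I * J).re := by simp; ring
    rw [hJI, Quaternion.re_neg] at h1
    linarith
  rw [mem_QSphere_iff] at hI hJ
  have key : ∀ {a b c d : ℝ}, (a : ℍ) + b * I + c * J + d * (I * J) = 0 → a = 0 := by
    intro a b c d h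
    simpa only [Quaternion.re_add, Quaternion.coe_mul_eq_smul,
      Quaternion.re_smul, Quaternion.re_coe, rI, rJ, rIJ, smul_zero, add_zero,
      Quaternion.re_zero] using congrArg (fun q : ℍ => q.re) h
  have hJIJ : J * (I * J) = I := by
    rw [← mul_assoc, hJI, neg_mul, mul_assoc, hJ]; simp
  have hIJI : I * J * I = J := by
    rw [mul_assoc, hJI, mul_neg, ← mul_assoc, hI]; simp
  refine ⟨key h, ?_, ?_, ?_⟩
  · have e : ((-b : ℝ) : ℍ) + (a : ℝ) * I + (d : ℝ) * J + ((-c : ℝ) : ℍ) * (I * J) =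
        ((a : ℍ) + b * I + c * J + d * (I * J)) * I := by
      simp only [add_mul, mul_assoc, hI, hJI, hIJI, mul_neg]
      push_cast; noncomm_ring
    rw [h, zero_mul] at e
    simpa using key e
  · have e : ((-c : ℝ) : ℍ) + ((-d : ℝ) : ℍ) * I + (a : ℝ) * J + (b : ℝ) * (I * J) =
        ((a : ℍ) + b * I + c * J + d * (I * J)) * J := by
      simp only [add_mul, mul_assoc, hJ]
      push_cast; noncomm_ring
    rw [h, zero_mul] at e
    simpa using key e
  · have e : ((-d : ℝ) : ℍ) + (c : ℝ) * I + ((-b : ℝ) : ℍ) * J + (a : ℝ) * (I * J) =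
        ((a : ℍ) + b * I + c * J + d * (I * J)) * (I * J) := by
      have h2 : I * J * (I * J) = -1 := by rw [mul_assoc, hJIJ, hI]
      have h3 : I * (I * J) = -J := by rw [← mul_assoc, hI]; simp
      rw [add_mul, add_mul, add_mul, mul_assoc _ _ (I * J), mul_assoc _ J, mul_assoc _ (I * J),
        h2, h3, hJIJ]
      push_cast; noncomm_ring
    rw [h, zero_mul] at e
    simpa using key e

/-- A function that is holomorphic with respect to left multiplication by `K` on the slice
`U ∩ ℂ_K` and vanishes on the real points of `U` vanishes on the slice. -/
theorem eq_zero_on_slice {U : Set ℍ} (hdom : SliceDomain U) {K : ℍ} (hK : K ∈ QSphere)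
    {F : ℍ → ℍ} (hd : DifferentiableOn ℝ F U)
    (hCR : ∀ q ∈ U ∩ slicePlane K, fderiv ℝ F q 1 + K * fderiv ℝ F q K = 0)
    (hreal : ∀ x : ℝ, (x : ℍ) ∈ U → F x = 0) :
    ∀ q ∈ U ∩ slicePlane K, F q = 0 := by
  obtain ⟨hopen, -, ⟨x₀, hx₀⟩, hconn⟩ := hdom
  have hK2 := mem_QSphere_iff.mp hK
  have hKre := QSphere.re_eq_zero_s5 hK
  intro p hp
  -- the parametrization `x + iy ↦ x + yK` of the slice
  let φ : ℂ →L[ℝ] ℍ := Complex.reCLM.smulRight (1 : ℍ) + Complex.imCLM.smulRight K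
  have hφ : ∀ z, φ z = (z.re : ℍ) + z.im • K := fun z => by
    simp [φ, ← Quaternion.coe_mul_eq_smul]
  -- its left inverse
  let ψ : ℍ → ℂ := fun q => ⟨q.re, ⟪K, q⟫_ℝ⟩
  have hψ : Continuous ψ := by
    have h : ψ = fun q => ((⟪(1 : ℍ), q⟫_ℝ : ℝ) : ℂ) + ((⟪K, q⟫_ℝ : ℝ) : ℂ) * Complex.I := by
      funext q
      apply Complex.ext <;> simp [ψ, Quaternion.inner_def]
    rw [h]
    fun_prop
  have hKK : ⟪K, K⟫_ℝ = 1 := by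
    have h : star K = -K := Quaternion.star_eq_neg.mpr hKre
    rw [Quaternion.inner_def, h, mul_neg, hK2]; simp
  have hψφ : ∀ z, ψ (φ z) = z := fun z => by
    apply Complex.ext
    · simp [ψ, hφ, hKre]
    · have h0 : ⟪K, (z.re : ℍ)⟫_ℝ = 0 := by simp [Quaternion.inner_def, hKre]
      simp only [ψ, hφ, inner_add_right, real_inner_smul_right, hKK, h0]
      ring
  let Ω : Set ℂ := φ ⁻¹' U
  have hΩo : IsOpen Ω := hopen.preimage φ.continuous
  have hΩc : IsPreconnected Ω := by
    have h : Ω = ψ '' (U ∩ slicePlane K) := by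
      ext z
      constructor
      · exact fun hz => ⟨φ z, ⟨hz, z.re, z.im, hφ z⟩, hψφ z⟩
      · rintro ⟨q, ⟨hq, x, y, rfl⟩, rfl⟩
        have e : (x : ℍ) + y • K = φ ⟨x, y⟩ := (hφ ⟨x, y⟩).symm
        rw [e] at hq ⊢
        rwa [hψφ]
    rw [h]
    exact (hconn K hK).image ψ hψ.continuousOn
  -- a real functional intertwining left multiplication by `K` with multiplication by `i`
  let w : ℍ := F p
  let L : ℍ →L[ℝ] ℂ := Complex.ofRealCLM ∘L innerSL ℝ w -
    Complex.I • (Complex.ofRealCLM ∘L innerSL ℝ w ∘L ContinuousLinearMap.mul ℝ ℍ K)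
  have hL : ∀ q, L q = (⟪w, q⟫_ℝ : ℂ) - Complex.I * (⟪w, K * q⟫_ℝ : ℂ) := fun q => by
    simp [L]
  have hLK : ∀ q, L (K * q) = Complex.I * L q := fun q => by
    rw [hL, hL, ← mul_assoc, hK2, neg_one_mul, inner_neg_right, mul_sub, ← mul_assoc,
      Complex.I_mul_I]
    push_cast
    ring
  let g : ℂ → ℂ := fun z => L (F (φ z))
  have hg : DifferentiableOn ℂ g Ω := by
    intro z hz
    have hF : HasFDerivAt F (fderiv ℝ F (φ z)) (φ z) :=
      ((hd _ hz).differentiableAt (hopen.mem_nhds hz)).hasFDerivAt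
    have hg' : HasFDerivAt g (L ∘L (fderiv ℝ F (φ z)) ∘L φ) z :=
      L.hasFDerivAt.comp z (hF.comp z φ.hasFDerivAt)
    refine (differentiableAt_complex_iff_differentiableAt_real.mpr
      ⟨hg'.differentiableAt, ?_⟩).differentiableWithinAt
    have e1 : φ 1 = 1 := by simp [hφ]
    have e2 : φ Complex.I = K := by simp [hφ]
    have h := hCR (φ z) ⟨hz, z.re, z.im, hφ z⟩
    have h' : fderiv ℝ F (φ z) 1 = -(K * fderiv ℝ F (φ z) K) := eq_neg_of_add_eq_zero_left h
    rw [hg'.fderiv]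
    simp only [ContinuousLinearMap.comp_apply, e1, e2, h', map_neg, hLK, smul_eq_mul]
    linear_combination (L (fderiv ℝ F (φ z) K)) * Complex.I_mul_I
  have hz₀ : (x₀ : ℂ) ∈ Ω := by simpa [Ω, hφ] using hx₀
  have hfreq : ∃ᶠ z in nhdsWithin (x₀ : ℂ) {(x₀ : ℂ)}ᶜ, g z = 0 := by
    have ht : Filter.Tendsto (fun t : ℝ => (t : ℂ)) (nhdsWithin x₀ {x₀}ᶜ)
        (nhdsWithin (x₀ : ℂ) {(x₀ : ℂ)}ᶜ) := by
      refine tendsto_nhdsWithin_iff.mpr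
        ⟨(Complex.continuous_ofReal.tendsto x₀).mono_left nhdsWithin_le_nhds, ?_⟩
      filter_upwards [self_mem_nhdsWithin] with t ht
      simpa using ht
    refine ht.frequently (Filter.Eventually.frequently ?_)
    have hnear : ∀ᶠ t : ℝ in nhds x₀, (t : ℂ) ∈ Ω :=
      Complex.continuous_ofReal.continuousAt.eventually_mem (hΩo.mem_nhds hz₀)
    filter_upwards [hnear.filter_mono nhdsWithin_le_nhds] with t ht
    have e : φ (t : ℂ) = (t : ℍ) := by simp [hφ]
    have ht' : φ (t : ℂ) ∈ U := ht
    rw [e] at ht'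
    simp only [g, e, hreal t ht', map_zero]
  have hzero := (hg.analyticOnNhd hΩo).eqOn_zero_of_preconnected_of_frequently_eq_zero
    hΩc hz₀ hfreq
  obtain ⟨hpU, x, y, hpxy⟩ := hp
  have ep : φ ⟨x, y⟩ = p := by rw [hφ, hpxy]
  have hpz : g ⟨x, y⟩ = 0 := hzero (show φ ⟨x, y⟩ ∈ U by rwa [ep])
  have hre := congrArg Complex.re hpz
  simp only [g, ep, hL, Complex.sub_re, Complex.ofReal_re, Complex.I_mul_re, Complex.ofReal_im,
    neg_zero, sub_zero, Complex.zero_re] at hre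
  exact inner_self_eq_zero.mp hre

theorem SliceRegularOn.add {U : Set ℍ} (hU : IsOpen U) {f g : ℍ → ℍ}
    (hf : SliceRegularOn f U) (hg : SliceRegularOn g U) :
    SliceRegularOn (fun q => f q + g q) U := by
  refine ⟨hf.1.add hg.1, fun K hK q hq => ?_⟩
  have h1 := (hf.1 q hq.1).differentiableAt (hU.mem_nhds hq.1)
  have h2 := (hg.1 q hq.1).differentiableAt (hU.mem_nhds hq.1)
  rw [fderiv_fun_add h1 h2]
  have e1 := hf.2 K hK q hq
  have e2 := hg.2 K hK q hq
  calc _ = (fderiv ℝ f q 1 + K * fderiv ℝ f q K) + (fderiv ℝ g q 1 + K * fderiv ℝ g q K) := by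
        simp only [add_apply, mul_add]; abel
    _ = 0 := by rw [e1, e2, add_zero]

theorem SliceRegularOn.mul_const {U : Set ℍ} (hU : IsOpen U) {f : ℍ → ℍ}
    (hf : SliceRegularOn f U) (c : ℍ) : SliceRegularOn (fun q => f q * c) U := by
  refine ⟨hf.1.mul_const c, fun K hK q hq => ?_⟩
  have h1 := (hf.1 q hq.1).differentiableAt (hU.mem_nhds hq.1)
  rw [fderiv_mul_const' h1]
  calc _ = (fderiv ℝ f q 1 + K * fderiv ℝ f q K) * c := by
        simp [add_mul, mul_assoc]
    _ = 0 := by rw [hf.2 K hK q hq, zero_mul]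

theorem mul_mul_mem_QSphere {u v K : ℍ} (huv : v * u = 1) (hK : K ∈ QSphere) :
    u * K * v ∈ QSphere := by
  have huv' : u * v = 1 := mul_eq_one_comm.mp huv
  rw [mem_QSphere_iff] at hK ⊢
  calc u * K * v * (u * K * v) = u * K * (v * u) * K * v := by noncomm_ring
    _ = u * (K * K) * v := by rw [huv]; noncomm_ring
    _ = -(u * v) := by rw [hK]; noncomm_ring
    _ = -1 := by rw [huv']

theorem mul_add_smul_mul {u v : ℍ} (huv : v * u = 1) (x y : ℝ) (K : ℍ) :
    u * ((x : ℍ) + y • K) * v = (x : ℍ) + y • (u * K * v) := by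
  rw [mul_add, add_mul, ← Quaternion.coe_commutes, mul_assoc, mul_eq_one_comm.mp huv, mul_one,
    mul_smul_comm, smul_mul_assoc]

/-- Conjugating a slice regular function by rotations of `ℍ` preserves slice regularity. -/
theorem SliceRegularOn.conj {U : Set ℍ} (hU : IsOpen U) (hsym : AxiallySymmetric U)
    {f : ℍ → ℍ} (hf : SliceRegularOn f U) {u v : ℍ} (huv : v * u = 1) :
    SliceRegularOn (fun q => v * f (u * q * v) * u) U := by
  let c : ℍ →L[ℝ] ℍ := ContinuousLinearMap.mulLeftRight ℝ ℍ u v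
  let d : ℍ →L[ℝ] ℍ := ContinuousLinearMap.mulLeftRight ℝ ℍ v u
  have hc : ∀ q, c q = u * q * v := fun q => by simp [c]
  have hdd : ∀ q, d q = v * q * u := fun q => by simp [d]
  have hmem : ∀ K ∈ QSphere, ∀ q ∈ U ∩ slicePlane K, c q ∈ U ∩ slicePlane (u * K * v) := by
    rintro K hK _ ⟨hq, x, y, rfl⟩
    rw [hc, mul_add_smul_mul huv]
    exact ⟨hsym x y K hK hq _ (mul_mul_mem_QSphere huv hK), x, y, rfl⟩
  have hder : ∀ K ∈ QSphere, ∀ q ∈ U ∩ slicePlane K,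
      HasFDerivAt (fun q => v * f (u * q * v) * u) (d ∘L fderiv ℝ f (c q) ∘L c) q := by
    intro K hK q hq
    have hcq := (hmem K hK q hq).1
    have hF : HasFDerivAt f (fderiv ℝ f (c q)) (c q) :=
      ((hf.1 _ hcq).differentiableAt (hU.mem_nhds hcq)).hasFDerivAt
    have h := d.hasFDerivAt.comp q (hF.comp q c.hasFDerivAt)
    refine h.congr_of_eventuallyEq (Filter.Eventually.of_forall fun r => ?_)
    simp [hc, hdd]
  refine ⟨fun q hq => ?_, fun K hK q hq => ?_⟩
  · obtain ⟨K, hK, hqK⟩ := exists_mem_slicePlane q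
    exact (hder K hK q ⟨hq, hqK⟩).differentiableAt.differentiableWithinAt
  · rw [(hder K hK q hq).fderiv]
    have h := hf.2 _ (mul_mul_mem_QSphere huv hK) _ (hmem K hK q hq)
    have huv' : u * v = 1 := mul_eq_one_comm.mp huv
    have e1 : c 1 = 1 := by rw [hc, mul_one, huv']
    simp only [ContinuousLinearMap.comp_apply, e1, hc K, hdd]
    rw [eq_neg_of_add_eq_zero_left h]
    generalize fderiv ℝ f (c q) (u * K * v) = A
    calc _ = -(v * u) * K * v * A * u + K * v * A * u := by noncomm_ring
      _ = 0 := by rw [huv]; noncomm_ring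

/-- The average of the conjugates of `f` by `1, I, J, IJ`: the intrinsic part of `f`. -/
noncomputable def intrinsicPart (I J : ℍ) (f : ℍ → ℍ) (q : ℍ) : ℍ :=
  (f q + -I * f (I * q * -I) * I + -J * f (J * q * -J) * J +
    -(I * J) * f (I * J * q * -(I * J)) * (I * J)) * ((4⁻¹ : ℝ) : ℍ)

theorem intrinsicOn_intrinsicPart {U : Set ℍ} (hdom : SliceDomain U)
    (hsym : AxiallySymmetric U) {I J : ℍ} (hI : I ∈ QSphere) (hJ : J ∈ QSphere)
    (hIJ : ⟪I, J⟫_ℝ = 0) {f : ℍ → ℍ} (hf : SliceRegularOn f U) :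
    IntrinsicOn (intrinsicPart I J f) U := by
  have hU := hdom.1
  have hJI := QSphere.anticomm hI hJ hIJ
  have hI2 := mem_QSphere_iff.mp hI
  have hJ2 := mem_QSphere_iff.mp hJ
  have hIJ2 : I * J * (I * J) = -1 := by
    rw [mul_assoc, ← mul_assoc J, hJI, neg_mul, mul_assoc I J J, hJ2, ← mul_neg, mul_neg I,
      mul_neg_one, neg_neg, hI2]
  have hreg : SliceRegularOn (intrinsicPart I J f) U :=
    ((((hf.add hU (hf.conj hU hsym (by rw [neg_mul, hI2, neg_neg]))).add hU
      (hf.conj hU hsym (by rw [neg_mul, hJ2, neg_neg]))).add hU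
      (hf.conj hU hsym (by rw [neg_mul, hIJ2, neg_neg]))).mul_const hU _)
  have hreal : ∀ x : ℝ, ∃ r : ℝ, intrinsicPart I J f x = r := by
    intro x
    have hx : ∀ u : ℍ, u * u = -1 → u * x * -u = x := fun u hu => by
      rw [← Quaternion.coe_commutes, mul_assoc, mul_neg, hu, neg_neg, mul_one]
    have e : intrinsicPart I J f x = (f x - I * f x * I - J * f x * J -
        I * J * f x * (I * J)) * ((4⁻¹ : ℝ) : ℍ) := by
      rw [intrinsicPart, hx I hI2, hx J hJ2, hx _ hIJ2]
      noncomm_ring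
    have hII : ∀ a, I * (I * a) = -a := fun a => by rw [← mul_assoc, hI2, neg_one_mul]
    have hJJ : ∀ a, J * (J * a) = -a := fun a => by rw [← mul_assoc, hJ2, neg_one_mul]
    have hJIa : ∀ a, J * (I * a) = -(I * (J * a)) := fun a => by
      rw [← mul_assoc, hJI, neg_mul, mul_assoc]
    refine eq_coe_of_mem_slicePlane hI hJ hIJ (mem_slicePlane_of_commute hI ?_)
      (mem_slicePlane_of_commute hJ ?_) <;> rw [e]
    · rw [Quaternion.mul_coe_eq_smul, smul_mul_assoc, mul_smul_comm]
      congr 1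
      simp only [sub_mul, mul_sub, mul_assoc, hI2, hJI, hII, mul_neg, mul_one, neg_neg]
      abel
    · rw [Quaternion.mul_coe_eq_smul, smul_mul_assoc, mul_smul_comm]
      congr 1
      simp only [sub_mul, mul_sub, mul_assoc, hJ2, hJJ, hJIa, mul_neg, mul_one, neg_neg]
      abel
  refine ⟨hreg, fun K hK q hq => mem_slicePlane_of_commute hK ?_⟩
  set h := intrinsicPart I J f
  have hd : ∀ q ∈ U, DifferentiableAt ℝ h q := fun q hq =>
    (hreg.1 q hq).differentiableAt (hU.mem_nhds hq)
  refine sub_eq_zero.mp (eq_zero_on_slice hdom hK (F := fun q => h q * K - K * h q)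
    ((hreg.1.mul_const K).sub (hreg.1.const_mul K)) (fun q hq => ?_) (fun x _ => ?_) q hq)
  · have hq' := hd q hq.1
    rw [fderiv_fun_sub (hq'.mul_const K) (hq'.const_mul K), fderiv_mul_const' hq',
      fderiv_const_mul hq']
    have e := hreg.2 K hK q hq
    calc _ = (fderiv ℝ h q 1 + K * fderiv ℝ h q K) * K
          - K * (fderiv ℝ h q 1 + K * fderiv ℝ h q K) := by
          simp
          noncomm_ring
      _ = 0 := by rw [e, zero_mul, mul_zero, sub_zero]
  · obtain ⟨r, hr⟩ := hreal x
    simp only [hr, Quaternion.coe_commutes, sub_self]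

theorem SliceRegularOn.eq_of_eq_on_real {U : Set ℍ} (hdom : SliceDomain U)
    {f g : ℍ → ℍ} (hf : SliceRegularOn f U) (hg : SliceRegularOn g U)
    (h : ∀ x : ℝ, (x : ℍ) ∈ U → f x = g x) : ∀ q ∈ U, f q = g q := by
  intro q hq
  obtain ⟨K, hK, hqK⟩ := exists_mem_slicePlane q
  have hs : SliceRegularOn (fun q => f q + g q * (-1)) U := hf.add hdom.1 (hg.mul_const hdom.1 _)
  have := eq_zero_on_slice hdom hK hs.1 (hs.2 K hK) (fun x hx => by simp [h x hx]) q ⟨hq, hqK⟩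
  rwa [mul_neg_one, ← sub_eq_add_neg, sub_eq_zero] at this

/-- Decomposition `𝓡(U) = 𝓝(U) ⊕ 𝓝(U)I ⊕ 𝓝(U)J ⊕ 𝓝(U)IJ`: every slice regular
function on an axially symmetric slice domain `U` is uniquely `f₀ + f₁I + f₂J + f₃IJ`
with each `fₗ` quaternionic intrinsic. -/
theorem intrinsic_decomposition (U : Set ℍ) (hdom : SliceDomain U)
    (hsym : AxiallySymmetric U)
    (I J : ℍ) (hI : I ∈ QSphere) (hJ : J ∈ QSphere) (hIJ : ⟪I, J⟫_ℝ = 0)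
    (f : ℍ → ℍ) (hf : SliceRegularOn f U) :
    ∃ f0 f1 f2 f3 : ℍ → ℍ,
      IntrinsicOn f0 U ∧ IntrinsicOn f1 U ∧ IntrinsicOn f2 U ∧ IntrinsicOn f3 U ∧
      (∀ q ∈ U, f q = f0 q + f1 q * I + f2 q * J + f3 q * (I * J)) ∧
      ∀ g0 g1 g2 g3 : ℍ → ℍ,
        IntrinsicOn g0 U → IntrinsicOn g1 U → IntrinsicOn g2 U → IntrinsicOn g3 U →
        (∀ q ∈ U, f q = g0 q + g1 q * I + g2 q * J + g3 q * (I * J)) →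
        ∀ q ∈ U, g0 q = f0 q ∧ g1 q = f1 q ∧ g2 q = f2 q ∧ g3 q = f3 q := by
  have hU := hdom.1
  have hJI := QSphere.anticomm hI hJ hIJ
  have hI2 := mem_QSphere_iff.mp hI
  have hJ2 := mem_QSphere_iff.mp hJ
  have hpart : ∀ c : ℍ, IntrinsicOn (intrinsicPart I J (fun q => f q * c)) U := fun c =>
    intrinsicOn_intrinsicPart hdom hsym hI hJ hIJ (hf.mul_const hU c)
  have hsum : ∀ q, f q = intrinsicPart I J (fun q => f q * 1) q +
      intrinsicPart I J (fun q => f q * -I) q * I +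
      intrinsicPart I J (fun q => f q * -J) q * J +
      intrinsicPart I J (fun q => f q * -(I * J)) q * (I * J) := by
    intro q
    have hII : ∀ a, I * (I * a) = -a := fun a => by rw [← mul_assoc, hI2, neg_one_mul]
    have hJIa : ∀ a, J * (I * a) = -(I * (J * a)) := fun a => by
      rw [← mul_assoc, hJI, neg_mul, mul_assoc]
    simp only [intrinsicPart]
    generalize f q = A, f (I * q * -I) = B, f (J * q * -J) = C,
      f (I * J * q * -(I * J)) = D
    simp only [mul_assoc, Quaternion.mul_coe_eq_smul, smul_mul_assoc,
      ← smul_add]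
    rw [eq_inv_smul_iff₀ (by norm_num : (4 : ℝ) ≠ 0)]
    simp only [add_mul, neg_mul, mul_assoc, hI2, hJ2, hJI, hII, hJIa, mul_neg, mul_one,
      one_mul, neg_neg]
    rw [show (4 : ℝ) • A = A + A + A + A by module]
    abel
  refine ⟨_, _, _, _, hpart 1, hpart (-I), hpart (-J), hpart (-(I * J)), fun q _ => hsum q, ?_⟩
  intro g0 g1 g2 g3 h0 h1 h2 h3 hg
  have hreal : ∀ {h : ℍ → ℍ}, IntrinsicOn h U → ∀ x : ℝ, (x : ℍ) ∈ U → ∃ r : ℝ, h x = r :=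
    fun hh x hx => eq_coe_of_mem_slicePlane hI hJ hIJ
      (hh.2 I hI x ⟨hx, coe_mem_slicePlane x I⟩) (hh.2 J hJ x ⟨hx, coe_mem_slicePlane x J⟩)
  have key : ∀ x : ℝ, (x : ℍ) ∈ U →
      g0 x = intrinsicPart I J (fun q => f q * 1) x ∧
      g1 x = intrinsicPart I J (fun q => f q * -I) x ∧
      g2 x = intrinsicPart I J (fun q => f q * -J) x ∧
      g3 x = intrinsicPart I J (fun q => f q * -(I * J)) x := by
    intro x hx
    have e := hg x hx
    rw [hsum x] at e
    obtain ⟨a0, ha0⟩ := hreal h0 x hx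
    obtain ⟨a1, ha1⟩ := hreal h1 x hx
    obtain ⟨a2, ha2⟩ := hreal h2 x hx
    obtain ⟨a3, ha3⟩ := hreal h3 x hx
    obtain ⟨b0, hb0⟩ := hreal (hpart 1) x hx
    obtain ⟨b1, hb1⟩ := hreal (hpart (-I)) x hx
    obtain ⟨b2, hb2⟩ := hreal (hpart (-J)) x hx
    obtain ⟨b3, hb3⟩ := hreal (hpart (-(I * J))) x hx
    rw [ha0, ha1, ha2, ha3, hb0, hb1, hb2, hb3] at e
    rw [ha0, ha1, ha2, ha3, hb0, hb1, hb2, hb3]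
    have hz : ((a0 - b0 : ℝ) : ℍ) + ((a1 - b1 : ℝ) : ℍ) * I + ((a2 - b2 : ℝ) : ℍ) * J +
        ((a3 - b3 : ℝ) : ℍ) * (I * J) = 0 := by
      rw [← sub_eq_zero.mpr e.symm]
      push_cast
      noncomm_ring
    obtain ⟨z0, z1, z2, z3⟩ := coe_eq_zero_of_basis_sum_eq_zero hI hJ hIJ hz
    rw [sub_eq_zero.mp z0, sub_eq_zero.mp z1, sub_eq_zero.mp z2, sub_eq_zero.mp z3]
    exact ⟨rfl, rfl, rfl, rfl⟩
  have huniq : ∀ {g h : ℍ → ℍ}, IntrinsicOn g U → IntrinsicOn h U →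
      (∀ x : ℝ, (x : ℍ) ∈ U → g x = h x) → ∀ q ∈ U, g q = h q := fun hg hh =>
    SliceRegularOn.eq_of_eq_on_real hdom hg.1 hh.1
  intro q hq
  exact ⟨huniq h0 (hpart 1) (fun x hx => (key x hx).1) q hq,
    huniq h1 (hpart (-I)) (fun x hx => (key x hx).2.1) q hq,
    huniq h2 (hpart (-J)) (fun x hx => (key x hx).2.2.1) q hq,
    huniq h3 (hpart (-(I * J))) (fun x hx => (key x hx).2.2.2) q hq⟩
end
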